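/- For every n ≥ 8 and every c = (c_0,…,c_{n−1}) ∈ F_2^n with c_{n−1} = 1: if c_{n−2} = 1 then f̂_0^n(c) = f̂_0^{n−1}(c^{n−1}) − 2(−1)^{c_{n−3}} f̂_0^{n−4}(c^{n−4}); if c_{n−2} = 0 and c_{n−3} = 0 then f̂_0^n(c) = f̂_0^{n−1}(c^{n−1}) − 2 f̂_0^{n−4}(c^{n−4}) − 4(−1)^{c_{n−4}} f̂_0^{n−5}(c^{n−5}); if c_{n−2} = 0 and c_{n−3} = 1 then f̂_0^n(c) = f̂_0^{n−1}(c^{n−1}) − 2 f̂_0^{n−4}(c^{n−4}) − 4(−1)^{c_{n−4}+c_{n−5}} f̂_2^{n−5}(c^{n−5} + e_{2^{n−6}}). -/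

import Mathlib

/-- Dot product on `F_2^n`. -/
def dotp (n : ℕ) (c x : Fin n → ZMod 2) : ZMod 2 := ∑ i, c i * x i

/-- Fourier transform of a Boolean function `f : F_2^n → F_2` at `c ∈ F_2^n`. -/
def walsh (n : ℕ) (f : (Fin n → ZMod 2) → ZMod 2) (c : Fin n → ZMod 2) : ℤ :=
  ∑ x : Fin n → ZMod 2, (-1 : ℤ) ^ (f x + dotp n c x).val

/-- The rotation symmetric function `F_3^n(x) = Σ_i x_i x_{i+1 mod n} x_{i+2 mod n}`. -/
def F3 (n : ℕ) (x : Fin n → ZMod 2) : ZMod 2 :=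
  ∑ i : Fin n, x i * x ⟨(i.val + 1) % n, Nat.mod_lt _ i.pos⟩
    * x ⟨(i.val + 2) % n, Nat.mod_lt _ i.pos⟩

/-- `t_m(x) = Σ_{i=0}^{m-3} x_i x_{i+1} x_{i+2}`. -/
def tm (m : ℕ) (x : Fin m → ZMod 2) : ZMod 2 :=
  ∑ i ∈ Finset.range m,
    if h : i + 2 < m then x ⟨i, by omega⟩ * x ⟨i + 1, by omega⟩ * x ⟨i + 2, by omega⟩ else 0

/-- `f_0^m = t_m`. -/
def f0 (m : ℕ) (x : Fin m → ZMod 2) : ZMod 2 := tm m x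

/-- `f_1^m = t_m + x_0 x_1`. -/
def f1 (m : ℕ) (x : Fin m → ZMod 2) : ZMod 2 :=
  if h : 2 ≤ m then tm m x + x ⟨0, by omega⟩ * x ⟨1, by omega⟩ else 0

/-- `f_2^m = t_m + x_{m-2} x_{m-1}`. -/
def f2 (m : ℕ) (x : Fin m → ZMod 2) : ZMod 2 :=
  if h : 2 ≤ m then tm m x + x ⟨m - 2, by omega⟩ * x ⟨m - 1, by omega⟩ else 0

/-- `f_3^m = t_m + x_0 x_1 + x_{m-2} x_{m-1} + x_0 + x_{m-1}`. -/
def f3 (m : ℕ) (x : Fin m → ZMod 2) : ZMod 2 :=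
  if h : 2 ≤ m then
    tm m x + x ⟨0, by omega⟩ * x ⟨1, by omega⟩ + x ⟨m - 2, by omega⟩ * x ⟨m - 1, by omega⟩
      + x ⟨0, by omega⟩ + x ⟨m - 1, by omega⟩
  else 0

/-- `c^m`: the vector of the first `m` coordinates of `c ∈ F_2^n`. -/
def trunc {n : ℕ} (m : ℕ) (h : m ≤ n) (c : Fin n → ZMod 2) : Fin m → ZMod 2 :=
  fun i => c (Fin.castLE h i)

/-- `e_1 = (1,0,…,0) ∈ F_2^m`. -/
def eOne (m : ℕ) : Fin m → ZMod 2 := fun i => if i.val = 0 then 1 else 0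

/-- `e_{2^{m-1}} = (0,…,0,1) ∈ F_2^m`. -/
def eLast (m : ℕ) : Fin m → ZMod 2 := fun i => if i.val = m - 1 then 1 else 0

/-- The weight of a Boolean function: the number of `x` with `f x = 1`. -/
def wt (n : ℕ) (f : (Fin n → ZMod 2) → ZMod 2) : ℕ :=
  (Finset.univ.filter fun x => f x = 1).card

/-- The additive character `z ↦ (-1)^z` of `F_2`. -/
def signChar (z : ZMod 2) : ℤ := (-1 : ℤ) ^ z.val

theorem signChar_add (a b : ZMod 2) : signChar (a + b) = signChar a * signChar b := by
  revert a b; decide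

/-- The sum `Σ_y (-1)^{t_{m+2}(y) + c·y} g(y_m, y_{m+1})` over `F_2^{m+2}`. -/
def twistedSum (m : ℕ) (g : ZMod 2 → ZMod 2 → ℤ) (c : ℕ → ZMod 2) : ℤ :=
  ∑ y : Fin (m + 2) → ZMod 2,
    signChar (tm (m + 2) y + dotp (m + 2) (fun i => c i) y)
      * g (y ⟨m, by omega⟩) (y ⟨m + 1, by omega⟩)

/-- The effect on the weight in `twistedSum` of summing out the last variable. -/
def transfer (γ : ZMod 2) (g : ZMod 2 → ZMod 2 → ℤ) (p q : ZMod 2) : ℤ :=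
  ∑ a : ZMod 2, signChar (p * q * a + γ * a) * g q a

theorem dotp_snoc (m : ℕ) (c : ℕ → ZMod 2) (y : Fin m → ZMod 2) (a : ZMod 2) :
    dotp (m + 1) (fun i => c i) (Fin.snoc (α := fun _ => ZMod 2) y a)
      = dotp m (fun i => c i) y + c m * a := by
  simp [dotp, Fin.sum_univ_castSucc]

theorem tm_snoc (m : ℕ) (y : Fin (m + 2) → ZMod 2) (a : ZMod 2) :
    tm (m + 3) (Fin.snoc (α := fun _ => ZMod 2) y a)
      = tm (m + 2) y + y ⟨m, by omega⟩ * y ⟨m + 1, by omega⟩ * a := by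
  have key : ∀ (N : ℕ) (x : Fin (N + 2) → ZMod 2), tm (N + 2) x
      = ∑ i : Fin N, x ⟨i, by omega⟩ * x ⟨i + 1, by omega⟩ * x ⟨i + 2, by omega⟩ := by
    intro N x
    rw [tm, Finset.sum_range_succ, Finset.sum_range_succ, dif_neg (by omega),
      dif_neg (by omega), add_zero, add_zero, Finset.sum_range]
    exact Finset.sum_congr rfl fun i _ => dif_pos (by omega)
  rw [key (m + 1), key m, Fin.sum_univ_castSucc]
  congr 1
  · refine Finset.sum_congr rfl fun i _ => ?_
    have h : ∀ (j : ℕ) (hj : j < m + 2), Fin.snoc (α := fun _ => ZMod 2) y a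
        (⟨j, by omega⟩ : Fin (m + 3)) = y ⟨j, hj⟩ := fun j hj =>
      Fin.snoc_castSucc (α := fun _ => ZMod 2) a y ⟨j, hj⟩
    have hi := i.isLt
    simp only [Fin.val_castSucc]
    rw [h _ (by omega), h _ (by omega), h _ (by omega)]
  · simp [Fin.snoc]

theorem twistedSum_succ (m : ℕ) (g : ZMod 2 → ZMod 2 → ℤ) (c : ℕ → ZMod 2) :
    twistedSum (m + 1) g c = twistedSum m (transfer (c (m + 2)) g) c := by
  unfold twistedSum transfer
  rw [← (Fin.snocEquiv fun _ : Fin (m + 3) => ZMod 2).sum_comp, Fintype.sum_prod_type,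
    Finset.sum_comm]
  refine Finset.sum_congr rfl fun y _ => ?_
  rw [Finset.mul_sum]
  refine Finset.sum_congr rfl fun a _ => ?_
  have h0 : Fin.snoc (α := fun _ => ZMod 2) y a (⟨m + 1, by omega⟩ : Fin (m + 3))
      = y ⟨m + 1, by omega⟩ :=
    Fin.snoc_castSucc (α := fun _ => ZMod 2) a y ⟨m + 1, by omega⟩
  have h1 : Fin.snoc (α := fun _ => ZMod 2) y a (⟨m + 2, by omega⟩ : Fin (m + 3)) = a :=
    Fin.snoc_last (α := fun _ => ZMod 2) a y
  have e : Fin.snocEquiv (fun _ : Fin (m + 3) => ZMod 2) (a, y)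
      = Fin.snoc (α := fun _ => ZMod 2) y a := rfl
  rw [e, tm_snoc, dotp_snoc (m + 2)]
  change _ * g (Fin.snoc (α := fun _ => ZMod 2) y a ⟨m + 1, by omega⟩)
    (Fin.snoc (α := fun _ => ZMod 2) y a ⟨m + 2, by omega⟩) = _
  rw [h0, h1, add_add_add_comm, signChar_add]
  ring

theorem walsh_f0 (m : ℕ) (c : ℕ → ZMod 2) :
    walsh (m + 2) (f0 (m + 2)) (fun i => c i) = twistedSum m (fun _ _ => 1) c := by
  simp [walsh, twistedSum, f0, signChar]

theorem walsh_f2_add_eLast (m : ℕ) (c : ℕ → ZMod 2) :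
    walsh (m + 2) (f2 (m + 2)) ((fun i : Fin (m + 2) => c i) + eLast (m + 2))
      = twistedSum m (fun p q => signChar (p * q + q)) c := by
  refine Finset.sum_congr rfl fun y _ => ?_
  have hd : dotp (m + 2) ((fun i : Fin (m + 2) => c i) + eLast (m + 2)) y
      = dotp (m + 2) (fun i => c i) y + y ⟨m + 1, by omega⟩ := by
    simp only [dotp, Pi.add_apply, add_mul, Finset.sum_add_distrib]
    congr 1
    rw [Fin.sum_univ_castSucc, Finset.sum_eq_zero]
    · simp [eLast, Fin.last]
    · intro i _
      have := i.isLt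
      simp [eLast, show (i : ℕ) ≠ m + 1 by omega]
  rw [hd, ← signChar_add, signChar, f2, dif_pos (by omega)]
  simp only [Nat.add_sub_cancel, show m + 2 - 1 = m + 1 from rfl]
  congr 2
  ring

theorem twistedSum_eq_sub (m : ℕ) (a : ℤ) {g g₁ g₂ : ZMod 2 → ZMod 2 → ℤ} (c : ℕ → ZMod 2)
    (h : ∀ p q, g p q = g₁ p q - a * g₂ p q) :
    twistedSum m g c = twistedSum m g₁ c - a * twistedSum m g₂ c := by
  simp only [twistedSum, Finset.mul_sum, ← Finset.sum_sub_distrib, h]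
  exact Finset.sum_congr rfl fun y _ => by ring

theorem twistedSum_eq_sub_sub (m : ℕ) (a b : ℤ) {g g₁ g₂ g₃ : ZMod 2 → ZMod 2 → ℤ}
    (c : ℕ → ZMod 2) (h : ∀ p q, g p q = g₁ p q - a * g₂ p q - b * g₃ p q) :
    twistedSum m g c
      = twistedSum m g₁ c - a * twistedSum m g₂ c - b * twistedSum m g₃ c := by
  simp only [twistedSum, Finset.mul_sum, ← Finset.sum_sub_distrib, h]
  exact Finset.sum_congr rfl fun y _ => by ring

theorem transfer_one_one (γ₃ γ₄ p q : ZMod 2) :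
    transfer γ₄ (transfer γ₃ (transfer 1 (transfer 1 fun _ _ => 1))) p q
      = transfer γ₄ (transfer γ₃ (transfer 1 fun _ _ => 1)) p q
        - 2 * (-1 : ℤ) ^ γ₃.val * 1 := by
  revert γ₃ γ₄ p q
  decide

theorem transfer_one_zero_zero (γ₄ γ₅ p q : ZMod 2) :
    transfer γ₅ (transfer γ₄ (transfer 0 (transfer 0 (transfer 1 fun _ _ => 1)))) p q
      = transfer γ₅ (transfer γ₄ (transfer 0 (transfer 0 fun _ _ => 1))) p q
        - 2 * transfer γ₅ (fun _ _ => 1) p q - 4 * (-1 : ℤ) ^ γ₄.val * 1 := by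
  revert γ₄ γ₅ p q
  decide

theorem transfer_one_zero_one (γ₄ γ₅ γ₆ p q : ZMod 2) :
    transfer γ₆ (transfer γ₅ (transfer γ₄ (transfer 1 (transfer 0 (transfer 1
        fun _ _ => 1))))) p q
      = transfer γ₆ (transfer γ₅ (transfer γ₄ (transfer 1 (transfer 0 fun _ _ => 1)))) p q
        - 2 * transfer γ₆ (transfer γ₅ fun _ _ => 1) p q
        - 4 * (-1 : ℤ) ^ (γ₄ + γ₅).val
          * transfer γ₆ (fun p q => signChar (p * q + q)) p q := by
  revert γ₄ γ₅ γ₆ p q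
  decide

/-- For every `n ≥ 8` and `c ∈ F_2^n` with `c_{n−1} = 1`, the three-case
recurrence for `f̂_0^n(c)` in terms of `f̂_0^{n−1}, f̂_0^{n−4}, f̂_0^{n−5}, f̂_2^{n−5}`. -/
theorem stmt_10 (n : ℕ) (hn : 8 ≤ n) (c : Fin n → ZMod 2)
    (hc : c ⟨n - 1, by omega⟩ = 1) :
    (c ⟨n - 2, by omega⟩ = 1 →
      walsh n (f0 n) c
        = walsh (n - 1) (f0 (n - 1)) (trunc (n - 1) (by omega) c)
          - 2 * (-1 : ℤ) ^ (c ⟨n - 3, by omega⟩).val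
              * walsh (n - 4) (f0 (n - 4)) (trunc (n - 4) (by omega) c))
    ∧ (c ⟨n - 2, by omega⟩ = 0 → c ⟨n - 3, by omega⟩ = 0 →
      walsh n (f0 n) c
        = walsh (n - 1) (f0 (n - 1)) (trunc (n - 1) (by omega) c)
          - 2 * walsh (n - 4) (f0 (n - 4)) (trunc (n - 4) (by omega) c)
          - 4 * (-1 : ℤ) ^ (c ⟨n - 4, by omega⟩).val
              * walsh (n - 5) (f0 (n - 5)) (trunc (n - 5) (by omega) c))
    ∧ (c ⟨n - 2, by omega⟩ = 0 → c ⟨n - 3, by omega⟩ = 1 →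
      walsh n (f0 n) c
        = walsh (n - 1) (f0 (n - 1)) (trunc (n - 1) (by omega) c)
          - 2 * walsh (n - 4) (f0 (n - 4)) (trunc (n - 4) (by omega) c)
          - 4 * (-1 : ℤ) ^ (c ⟨n - 4, by omega⟩ + c ⟨n - 5, by omega⟩).val
              * walsh (n - 5) (f2 (n - 5))
                  (trunc (n - 5) (by omega) c + eLast (n - 5))) := by
  obtain ⟨m, rfl⟩ : ∃ m, n = m + 8 := ⟨n - 8, by omega⟩
  obtain ⟨d, rfl⟩ : ∃ d : ℕ → ZMod 2, c = fun i : Fin (m + 8) => d i :=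
    ⟨fun i => if h : i < m + 8 then c ⟨i, h⟩ else 0, by ext i; simp⟩
  change d (m + 7) = 1 at hc
  change (d (m + 6) = 1 →
      walsh (m + 8) (f0 (m + 8)) (fun i => d i)
        = walsh (m + 7) (f0 (m + 7)) (fun i => d i)
          - 2 * (-1 : ℤ) ^ (d (m + 5)).val * walsh (m + 4) (f0 (m + 4)) (fun i => d i))
    ∧ (d (m + 6) = 0 → d (m + 5) = 0 →
      walsh (m + 8) (f0 (m + 8)) (fun i => d i)
        = walsh (m + 7) (f0 (m + 7)) (fun i => d i)
          - 2 * walsh (m + 4) (f0 (m + 4)) (fun i => d i)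
          - 4 * (-1 : ℤ) ^ (d (m + 4)).val * walsh (m + 3) (f0 (m + 3)) (fun i => d i))
    ∧ (d (m + 6) = 0 → d (m + 5) = 1 →
      walsh (m + 8) (f0 (m + 8)) (fun i => d i)
        = walsh (m + 7) (f0 (m + 7)) (fun i => d i)
          - 2 * walsh (m + 4) (f0 (m + 4)) (fun i => d i)
          - 4 * (-1 : ℤ) ^ (d (m + 4) + d (m + 3)).val
              * walsh (m + 3) (f2 (m + 3)) ((fun i : Fin (m + 3) => d i) + eLast (m + 3)))
  rw [walsh_f0 (m + 6), walsh_f0 (m + 5), walsh_f0 (m + 2), walsh_f0 (m + 1),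
    walsh_f2_add_eLast (m + 1)]
  refine ⟨fun h6 => ?_, fun h6 h5 => ?_, fun h6 h5 => ?_⟩
  · simp only [twistedSum_succ (m + 5), twistedSum_succ (m + 4), twistedSum_succ (m + 3),
      twistedSum_succ (m + 2), hc, h6]
    exact twistedSum_eq_sub _ _ d (transfer_one_one _ _)
  · simp only [twistedSum_succ (m + 5), twistedSum_succ (m + 4), twistedSum_succ (m + 3),
      twistedSum_succ (m + 2), twistedSum_succ (m + 1), hc, h6, h5]
    exact twistedSum_eq_sub_sub _ _ _ d (transfer_one_zero_zero _ _)
  · simp only [twistedSum_succ (m + 5), twistedSum_succ (m + 4), twistedSum_succ (m + 3),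
      twistedSum_succ (m + 2), twistedSum_succ (m + 1), twistedSum_succ m, hc, h6, h5]
    exact twistedSum_eq_sub_sub _ _ _ d (transfer_one_zero_one _ _ _)
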